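/- There is an absolute constant C such that for every Schwartz function q on ℝ and every N ≥ 1, ∫_ℝ |q(x)|⁶ dx ≤ C·( N²·(∫_ℝ |q(x)|² dx)³ + (∫_{|ξ|>N} |q̂(ξ)|² dξ)²·∫_ℝ |q'(x)|² dx ). -/

import Mathlib

open MeasureTheory

/-- The Fourier transform with the paper's normalization
`q̂(ξ) = (2π)^{−1/2} ∫ e^{−iξx} q(x) dx`. -/
noncomputable def ft (f : ℝ → ℂ) (ξ : ℝ) : ℂ :=
  (Real.sqrt (2 * Real.pi))⁻¹ • ∫ x : ℝ, Complex.exp (-(Complex.I * ξ * x)) * f x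

open scoped SchwartzMap FourierTransform

/-- The Cauchy–Schwarz inequality for integrals of products of norms. -/
lemma sq_integral_norm_mul_norm_le {α E F : Type*} [MeasurableSpace α] {μ : Measure α}
    [NormedAddCommGroup E] [NormedAddCommGroup F] {f : α → E} {g : α → F}
    (hf : MemLp f 2 μ) (hg : MemLp g 2 μ) :
    (∫ x, ‖f x‖ * ‖g x‖ ∂μ) ^ 2 ≤ (∫ x, ‖f x‖ ^ 2 ∂μ) * ∫ x, ‖g x‖ ^ 2 ∂μ := by
  have h := integral_mul_norm_le_Lp_mul_Lq (μ := μ) (f := fun x ↦ ‖f x‖) (g := fun x ↦ ‖g x‖)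
    Real.HolderConjugate.two_two (by simpa using hf.norm) (by simpa using hg.norm)
  simp only [norm_norm, Real.rpow_two, ← Real.sqrt_eq_rpow] at h
  calc _ ≤ (√(∫ x, ‖f x‖ ^ 2 ∂μ) * √(∫ x, ‖g x‖ ^ 2 ∂μ)) ^ 2 := by
        gcongr
    _ = _ := by
        rw [mul_pow, Real.sq_sqrt (integral_nonneg fun x ↦ by positivity),
          Real.sq_sqrt (integral_nonneg fun x ↦ by positivity)]

namespace SchwartzMap

lemma integrable_norm_pow (f : 𝓢(ℝ, ℂ)) {n : ℕ} (hn : n ≠ 0) :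
    Integrable fun x ↦ ‖f x‖ ^ n :=
  (f.memLp n).integrable_norm_pow hn

/-- Agmon's inequality on the line. -/
lemma norm_pow_four_le (f : 𝓢(ℝ, ℂ)) (x : ℝ) :
    ‖f x‖ ^ 4 ≤ 4 * ((∫ y, ‖f y‖ ^ 2) * ∫ y, ‖deriv f y‖ ^ 2) := by
  have hf : MemLp f 2 := f.memLp 2
  have hf' : MemLp (deriv f) 2 := (derivCLM ℂ ℂ f).memLp 2 volume
  have hprod : Integrable fun y ↦ 2 * (‖f y‖ * ‖deriv f y‖) :=
    (hf.norm.integrable_mul hf'.norm).const_mul 2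
  have hbound (y : ℝ) : ‖2 * inner ℝ (f y) (deriv f y)‖ ≤ 2 * (‖f y‖ * ‖deriv f y‖) := by
    rw [norm_mul, Real.norm_ofNat]
    gcongr
    exact norm_inner_le_norm _ _
  have hint : Integrable fun y ↦ 2 * inner ℝ (f y) (deriv f y) :=
    hprod.mono' (by
      have := (derivCLM ℂ ℂ f).continuous
      exact (continuous_const.mul (f.continuous.inner this)).aestronglyMeasurable)
      (.of_forall hbound)
  have hlim : Filter.Tendsto (fun y ↦ ‖f y‖ ^ 2) Filter.atBot (nhds 0) := by
    simpa using ((zero_at_infty f).mono_left atBot_le_cocompact).norm.pow 2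
  have hftc := integral_Iic_of_hasDerivAt_of_tendsto' (a := x)
    (fun y _ ↦ (f.hasDerivAt y).norm_sq) hint.integrableOn hlim
  have hsq : ‖f x‖ ^ 2 ≤ 2 * ∫ y, ‖f y‖ * ‖deriv f y‖ := by
    rw [sub_zero] at hftc
    rw [← hftc, ← integral_const_mul]
    calc _ ≤ ∫ y in Set.Iic x, 2 * (‖f y‖ * ‖deriv f y‖) :=
          setIntegral_mono hint.integrableOn hprod.integrableOn
            fun y ↦ (le_abs_self _).trans (hbound y)
      _ ≤ _ := setIntegral_le_integral hprod (.of_forall fun y ↦ by positivity)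
  calc ‖f x‖ ^ 4 = (‖f x‖ ^ 2) ^ 2 := by ring
    _ ≤ (2 * ∫ y, ‖f y‖ * ‖deriv f y‖) ^ 2 := by gcongr
    _ = 4 * (∫ y, ‖f y‖ * ‖deriv f y‖) ^ 2 := by ring
    _ ≤ _ := by gcongr; exact sq_integral_norm_mul_norm_le hf hf'

lemma integral_norm_pow_six_le {f : 𝓢(ℝ, ℂ)} {B : ℝ} (hB : ∀ x, ‖f x‖ ^ 4 ≤ B) :
    ∫ x, ‖f x‖ ^ 6 ≤ B * ∫ x, ‖f x‖ ^ 2 := by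
  rw [← integral_const_mul]
  refine integral_mono (f.integrable_norm_pow (by simp))
    ((f.integrable_norm_pow (by simp)).const_mul B) fun x ↦ ?_
  calc ‖f x‖ ^ 6 = ‖f x‖ ^ 4 * ‖f x‖ ^ 2 := by ring
    _ ≤ B * ‖f x‖ ^ 2 := by gcongr; exact hB x

/-- The Gagliardo–Nirenberg inequality for the `L⁶` norm on the line. -/
lemma integral_norm_pow_six_le_integral_deriv (f : 𝓢(ℝ, ℂ)) :
    ∫ x, ‖f x‖ ^ 6 ≤ 4 * ((∫ x, ‖f x‖ ^ 2) ^ 2 * ∫ x, ‖deriv f x‖ ^ 2) :=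
  (integral_norm_pow_six_le f.norm_pow_four_le).trans_eq (by ring)

/-- Bernstein's inequality from `L²` to `L^∞`. -/
lemma norm_sq_le_of_fourier_eq_zero {f : 𝓢(ℝ, ℂ)} {R : ℝ} (hR : 0 ≤ R)
    (hf : ∀ ξ, R < |ξ| → 𝓕 f ξ = 0) (x : ℝ) :
    ‖f x‖ ^ 2 ≤ 2 * R * ∫ y, ‖f y‖ ^ 2 := by
  have hle : ‖f x‖ ≤ ∫ ξ in Set.Icc (-R) R, ‖𝓕 f ξ‖ := by
    have hzero : ∀ ξ ∉ Set.Icc (-R) R, ‖𝓕 f ξ‖ = 0 := fun ξ hξ ↦ by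
      rw [hf ξ (by rwa [Set.mem_Icc, ← abs_le, not_le] at hξ), norm_zero]
    rw [setIntegral_eq_integral_of_forall_compl_eq_zero hzero]
    calc ‖f x‖ = ‖𝓕⁻ (⇑(𝓕 f : 𝓢(ℝ, ℂ))) x‖ := by
          rw [← fourierInv_coe, FourierTransform.fourierInv_fourier_eq]
      _ ≤ _ := by
          rw [Real.fourierInv_eq]
          exact (norm_integral_le_integral_norm _).trans_eq (by simp)
  have hcs := sq_integral_norm_mul_norm_le (μ := volume.restrict (Set.Icc (-R) R))
    (memLp_const (1 : ℝ)) (((𝓕 f).memLp 2).restrict (Set.Icc (-R) R))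
  simp only [norm_one, one_mul, one_pow, integral_const, measureReal_restrict_apply_univ,
    Real.volume_real_Icc, smul_eq_mul, mul_one, sub_neg_eq_add] at hcs
  rw [max_eq_left (by linarith)] at hcs
  calc ‖f x‖ ^ 2 ≤ _ := pow_le_pow_left₀ (norm_nonneg _) hle 2
    _ ≤ _ := hcs
    _ ≤ (R + R) * ∫ ξ, ‖𝓕 f ξ‖ ^ 2 := by
        refine mul_le_mul_of_nonneg_left ?_ (by linarith)
        exact setIntegral_le_integral ((𝓕 f).integrable_norm_pow two_ne_zero)
          (.of_forall fun ξ ↦ by positivity)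
    _ = _ := by rw [integral_norm_sq_fourier]; ring

/-- The Fourier multiplier with symbol `m` acts by multiplication on the Fourier side. -/
lemma fourier_fourierMultiplierCLM_apply {m : ℝ → ℝ} (hm : m.HasTemperateGrowth)
    (f : 𝓢(ℝ, ℂ)) (ξ : ℝ) :
    𝓕 (fourierMultiplierCLM ℂ m f) ξ = m ξ * 𝓕 f ξ := by
  rw [fourierMultiplierCLM_apply, FourierTransform.fourier_fourierInv_eq,
    smulLeftCLM_apply_apply hm, Complex.real_smul]

lemma integral_norm_sq_le_of_norm_fourier_le {f g : 𝓢(ℝ, ℂ)}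
    (h : ∀ ξ, ‖𝓕 f ξ‖ ≤ ‖𝓕 g ξ‖) : ∫ x, ‖f x‖ ^ 2 ≤ ∫ x, ‖g x‖ ^ 2 := by
  rw [← integral_norm_sq_fourier f, ← integral_norm_sq_fourier g]
  refine integral_mono ((𝓕 f).integrable_norm_pow (by simp))
    ((𝓕 g).integrable_norm_pow (by simp)) fun ξ ↦ ?_
  gcongr
  exact h ξ

lemma fourier_derivCLM_apply (f : 𝓢(ℝ, ℂ)) (ξ : ℝ) :
    𝓕 (derivCLM ℂ ℂ f) ξ = (2 * Real.pi * Complex.I * ξ) * 𝓕 f ξ := by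
  have h := Real.fourier_deriv f.integrable f.differentiable (derivCLM ℂ ℂ f).integrable
  exact congrFun h ξ

lemma integral_norm_deriv_sq_le_of_norm_fourier_le {f g : 𝓢(ℝ, ℂ)}
    (h : ∀ ξ, ‖𝓕 f ξ‖ ≤ ‖𝓕 g ξ‖) : ∫ x, ‖deriv f x‖ ^ 2 ≤ ∫ x, ‖deriv g x‖ ^ 2 := by
  refine integral_norm_sq_le_of_norm_fourier_le (f := derivCLM ℂ ℂ f) (g := derivCLM ℂ ℂ g)
    fun ξ ↦ ?_
  simp only [fourier_derivCLM_apply, norm_mul]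
  gcongr
  exact h ξ

/-- A smooth splitting of a Schwartz function at frequency `M`: the first part has frequencies at
most `2 * M`, the second has frequencies at least `M`. -/
lemma exists_add_eq_frequency_splitting (q : 𝓢(ℝ, ℂ)) {M : ℝ} (hM : 0 < M) :
    ∃ l h : 𝓢(ℝ, ℂ), l + h = q ∧
      (∀ ξ, ‖𝓕 l ξ‖ ≤ ‖𝓕 q ξ‖) ∧ (∀ ξ, 2 * M < |ξ| → 𝓕 l ξ = 0) ∧
      (∀ ξ, ‖𝓕 h ξ‖ ≤ ‖𝓕 q ξ‖) ∧ (∀ ξ, |ξ| ≤ M → 𝓕 h ξ = 0) := by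
  let χ : ContDiffBump (0 : ℝ) := ⟨M, 2 * M, hM, by linarith⟩
  have hχ : Function.HasTemperateGrowth (χ : ℝ → ℝ) :=
    χ.hasCompactSupport.hasTemperateGrowth χ.contDiff
  have hlow (ξ : ℝ) := fourier_fourierMultiplierCLM_apply hχ q ξ
  have hhigh (ξ : ℝ) : 𝓕 (q - fourierMultiplierCLM ℂ χ q) ξ = ((1 - χ ξ : ℝ) : ℂ) * 𝓕 q ξ := by
    rw [sub_eq_add_neg, FourierTransform.fourier_add, FourierTransform.fourier_neg, add_apply,
      neg_apply, hlow]
    push_cast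
    ring
  refine ⟨fourierMultiplierCLM ℂ χ q, q - fourierMultiplierCLM ℂ χ q, by abel,
    fun ξ ↦ ?_, fun ξ hξ ↦ ?_, fun ξ ↦ ?_, fun ξ hξ ↦ ?_⟩
  · rw [hlow, norm_mul, Complex.norm_of_nonneg χ.nonneg]
    exact mul_le_of_le_one_left (norm_nonneg _) χ.le_one
  · rw [hlow, χ.zero_of_le_dist (by simpa using hξ.le)]
    simp
  · rw [hhigh, norm_mul, Complex.norm_of_nonneg (sub_nonneg.2 χ.le_one)]
    exact mul_le_of_le_one_left (norm_nonneg _) (sub_le_self _ χ.nonneg)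
  · rw [hhigh, χ.one_of_mem_closedBall (by simpa using hξ)]
    simp

end SchwartzMap

lemma ft_eq_fourier (f : ℝ → ℂ) (ξ : ℝ) :
    ft f ξ = (Real.sqrt (2 * Real.pi))⁻¹ • 𝓕 f (ξ / (2 * Real.pi)) := by
  rw [ft, Real.fourier_real_eq_integral_exp_smul]
  congr 2 with x
  rw [smul_eq_mul]
  congr 2
  push_cast
  have := Complex.ofReal_ne_zero.2 Real.pi_ne_zero
  field_simp

lemma setIntegral_norm_sq_ft (f : ℝ → ℂ) (N : ℝ) :
    ∫ ξ in {ξ : ℝ | N < |ξ|}, ‖ft f ξ‖ ^ 2 =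
      ∫ ξ in {ξ : ℝ | N / (2 * Real.pi) < |ξ|}, ‖𝓕 f ξ‖ ^ 2 := by
  have hpi : 0 < 2 * Real.pi := Real.two_pi_pos
  have hmeas (R : ℝ) : MeasurableSet {ξ : ℝ | R < |ξ|} :=
    measurableSet_lt measurable_const measurable_norm
  have hscale := Measure.integral_comp_div
    ({ξ : ℝ | N / (2 * Real.pi) < |ξ|}.indicator fun ξ ↦ ‖𝓕 f ξ‖ ^ 2) (2 * Real.pi)
  rw [integral_indicator (hmeas _), abs_of_pos hpi, smul_eq_mul] at hscale
  rw [← mul_right_inj' hpi.ne', ← hscale, ← integral_indicator (hmeas _), ← integral_const_mul]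
  congr 1 with ξ
  have hiff : N / (2 * Real.pi) < |ξ / (2 * Real.pi)| ↔ N < |ξ| := by
    rw [abs_div, abs_of_pos hpi, div_lt_div_iff_of_pos_right hpi]
  simp only [Set.indicator_apply, Set.mem_ofPred_eq, hiff]
  split_ifs
  · rw [ft_eq_fourier, norm_smul, mul_pow, norm_inv, inv_pow, Real.norm_eq_abs, sq_abs,
      Real.sq_sqrt hpi.le, mul_inv_cancel_left₀ hpi.ne']
  · simp

lemma integral_norm_sq_le_setIntegral_norm_sq_ft {q h : 𝓢(ℝ, ℂ)} {N : ℝ}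
    (hle : ∀ ξ, ‖𝓕 h ξ‖ ≤ ‖𝓕 q ξ‖) (hzero : ∀ ξ, |ξ| ≤ N / (2 * Real.pi) → 𝓕 h ξ = 0) :
    ∫ x, ‖h x‖ ^ 2 ≤ ∫ ξ in {ξ : ℝ | N < |ξ|}, ‖ft q ξ‖ ^ 2 := by
  rw [setIntegral_norm_sq_ft, ← SchwartzMap.integral_norm_sq_fourier,
    ← setIntegral_eq_integral_of_forall_compl_eq_zero (s := {ξ | N / (2 * Real.pi) < |ξ|})
      fun ξ hξ ↦ by simp [hzero ξ (not_lt.1 hξ)]]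
  refine setIntegral_mono ((𝓕 h).integrable_norm_pow (by simp)).integrableOn
    ((𝓕 q).integrable_norm_pow (by simp)).integrableOn fun ξ ↦ ?_
  gcongr
  exact hle ξ

/-- The frequency-splitting `L⁶` estimate from the proof of Proposition 4.1 of
the paper: `‖q‖_{L⁶}⁶ ≲ N² ‖q‖_{L²}⁶ + ‖q_{>N}‖_{L²}⁴ ‖q'‖_{L²}²`. -/
theorem L6_frequency_splitting :
    ∃ C : ℝ, 0 < C ∧ ∀ q : SchwartzMap ℝ ℂ, ∀ N : ℝ, 1 ≤ N →
      (∫ x : ℝ, ‖q x‖ ^ 6) ≤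
        C * (N ^ 2 * (∫ x : ℝ, ‖q x‖ ^ 2) ^ 3 +
          (∫ ξ in {ξ : ℝ | N < |ξ|}, ‖ft (⇑q) ξ‖ ^ 2) ^ 2 *
            (∫ x : ℝ, ‖deriv (⇑q) x‖ ^ 2)) := by
  refine ⟨512, by norm_num, fun q N hN ↦ ?_⟩
  obtain ⟨l, h, hlh, hl, hl₀, hh, hh₀⟩ :=
    q.exists_add_eq_frequency_splitting (M := N / (2 * Real.pi)) (by positivity)
  have hsplit : ∫ x, ‖q x‖ ^ 6 ≤ 32 * ((∫ x, ‖l x‖ ^ 6) + ∫ x, ‖h x‖ ^ 6) := by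
    have hl₆ := l.integrable_norm_pow (n := 6) (by simp)
    have hh₆ := h.integrable_norm_pow (n := 6) (by simp)
    rw [← integral_add hl₆ hh₆, ← integral_const_mul]
    refine integral_mono (q.integrable_norm_pow (by simp)) ((hl₆.add hh₆).const_mul 32)
      fun x ↦ ?_
    calc ‖q x‖ ^ 6 ≤ (‖l x‖ + ‖h x‖) ^ 6 := by
          rw [← hlh, add_apply]
          gcongr
          exact norm_add_le _ _
      _ ≤ 2 ^ (6 - 1) * (‖l x‖ ^ 6 + ‖h x‖ ^ 6) :=
          add_pow_le (norm_nonneg _) (norm_nonneg _) 6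
      _ = _ := by norm_num
  have hA : 0 ≤ ∫ x, ‖q x‖ ^ 2 := integral_nonneg fun x ↦ by positivity
  have hlA : ∫ x, ‖l x‖ ^ 2 ≤ ∫ x, ‖q x‖ ^ 2 :=
    SchwartzMap.integral_norm_sq_le_of_norm_fourier_le hl
  have hMN : N / (2 * Real.pi) ≤ N :=
    div_le_self (by linarith) (by linarith [Real.pi_gt_three])
  have hlow : ∫ x, ‖l x‖ ^ 6 ≤ 16 * (N ^ 2 * (∫ x, ‖q x‖ ^ 2) ^ 3) := by
    have hsup (x : ℝ) : ‖l x‖ ^ 4 ≤ (4 * N * ∫ x, ‖q x‖ ^ 2) ^ 2 := by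
      calc ‖l x‖ ^ 4 = (‖l x‖ ^ 2) ^ 2 := by ring
        _ ≤ (2 * (2 * (N / (2 * Real.pi))) * ∫ x, ‖l x‖ ^ 2) ^ 2 := by
            gcongr
            exact SchwartzMap.norm_sq_le_of_fourier_eq_zero (by positivity) hl₀ x
        _ ≤ (2 * (2 * N) * ∫ x, ‖q x‖ ^ 2) ^ 2 := by gcongr
        _ = _ := by ring
    calc _ ≤ _ := SchwartzMap.integral_norm_pow_six_le hsup
      _ ≤ (4 * N * ∫ x, ‖q x‖ ^ 2) ^ 2 * ∫ x, ‖q x‖ ^ 2 := by gcongr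
      _ = _ := by ring
  have hhigh : ∫ x, ‖h x‖ ^ 6 ≤ 4 * ((∫ ξ in {ξ : ℝ | N < |ξ|}, ‖ft (⇑q) ξ‖ ^ 2) ^ 2 *
      ∫ x, ‖deriv (⇑q) x‖ ^ 2) := by
    refine h.integral_norm_pow_six_le_integral_deriv.trans ?_
    have hH := integral_norm_sq_le_setIntegral_norm_sq_ft hh hh₀
    have hD := SchwartzMap.integral_norm_deriv_sq_le_of_norm_fourier_le hh
    gcongr ?_ * (?_ * ?_)
    gcongr
  have hHD : 0 ≤ (∫ ξ in {ξ : ℝ | N < |ξ|}, ‖ft (⇑q) ξ‖ ^ 2) ^ 2 *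
      ∫ x, ‖deriv (⇑q) x‖ ^ 2 :=
    mul_nonneg (sq_nonneg _) (integral_nonneg fun x ↦ by positivity)
  linarith
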